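/- arXiv:2510.24977 — 7 statements merged into one kernel-verified Lean document; each statement's English description precedes it below -/
import Mathlib

section
/- Assume r ≥ 2 and 0 < s < n. If Γ ⊆ (Fin n → ℕ) is a G-graph, then every element m ∈ Γ has at most one nonzero coordinate; that is, m = a·e_k for some a ∈ ℕ and some k < n, where e_k denotes the k-th standard exponent vector. (Auxiliary step in the proof of Proposition 3.1.) -/
/-- The weight `wt(m) = (∑_{s≤j<n} m_j − ∑_{i<s} m_i) mod r ∈ ℤ/rℤ` of an
exponent vector `m`. -/
def wtv (n r s : ℕ) (m : Fin n → ℕ) : ZMod r :=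
  (∑ j : Fin n, if s ≤ (j : ℕ) then (m j : ZMod r) else 0) -
    ∑ i : Fin n, if (i : ℕ) < s then (m i : ZMod r) else 0

/-- A finite set `Γ ⊆ (Fin n → ℕ)` is a `G`-graph if it contains `0`, is
downward closed, and `wt` restricts to a bijection from `Γ` onto `ℤ/rℤ`. -/
def IsGGraph (n r s : ℕ) (Γ : Finset (Fin n → ℕ)) : Prop :=
  0 ∈ Γ ∧ (∀ m ∈ Γ, ∀ m' : Fin n → ℕ, m' ≤ m → m' ∈ Γ) ∧
    Set.BijOn (wtv n r s) (Γ : Set (Fin n → ℕ)) Set.univ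

theorem wtv_add_aux (n r s : ℕ) (a b : Fin n → ℕ) :
    wtv n r s (a + b) = wtv n r s a + wtv n r s b := by
  unfold wtv
  have h1 : ∀ (p : Fin n → Prop) [DecidablePred p],
      (∑ j : Fin n, if p j then (((a + b) j : ℕ) : ZMod r) else 0) =
        (∑ j : Fin n, if p j then (a j : ZMod r) else 0) +
          ∑ j : Fin n, if p j then (b j : ZMod r) else 0 := by
    intro p _
    rw [← Finset.sum_add_distrib]
    refine Finset.sum_congr rfl fun j _ => ?_
    split_ifs <;> simp
  rw [h1, h1]
  ring

theorem wtv_single_aux (n r s : ℕ) (k : Fin n) :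
    wtv n r s (Pi.single k 1) = if s ≤ (k : ℕ) then 1 else -1 := by
  unfold wtv
  rw [Finset.sum_eq_single k, Finset.sum_eq_single k]
  · by_cases h : s ≤ (k : ℕ)
    · simp [h, Nat.not_lt.mpr h]
    · simp [h, Nat.not_le.mp h]
  all_goals simp +contextual [Pi.single_apply]

/-- If `r ≥ 2`, `0 < s < n` and `Γ` is a `G`-graph, then every
`m ∈ Γ` has at most one nonzero coordinate: `m = a·e_k` for some `a ∈ ℕ`,
`k < n`. -/
theorem gGraph_mem_single (n r s : ℕ) (hr : 2 ≤ r) (hs0 : 0 < s) (hsn : s < n)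
    (Γ : Finset (Fin n → ℕ)) (hΓ : IsGGraph n r s Γ) :
    ∀ m ∈ Γ, ∃ (a : ℕ) (k : Fin n), m = Pi.single k a := by
  obtain ⟨h0, hd, hb⟩ := hΓ
  intro m hm
  have key : ∀ k l : Fin n, m k ≠ 0 → m l ≠ 0 → k = l := by
    intro k l hk hl
    by_contra hkl
    have hlk : l ≠ k := fun h => hkl h.symm
    have hsum : (Pi.single k 1 + Pi.single l 1 : Fin n → ℕ) ∈ Γ := by
      refine hd m hm _ fun i => ?_
      by_cases h1 : i = k
      · subst h1
        simp [hkl]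
        omega
      · by_cases h2 : i = l
        · subst h2
          simp [h1]
          omega
        · simp [h1, h2]
    have hk' : (Pi.single k 1 : Fin n → ℕ) ∈ Γ := hd _ hsum _ (by simp)
    have hl' : (Pi.single l 1 : Fin n → ℕ) ∈ Γ := hd _ hsum _ (by simp)
    by_cases hw : wtv n r s (Pi.single k 1) = wtv n r s (Pi.single l 1)
    · have h := congrFun (hb.injOn hk' hl' hw) k
      simp [hkl] at h
    · have hz : wtv n r s (Pi.single k 1 + Pi.single l 1) = wtv n r s 0 := by
        rw [wtv_add_aux]
        rw [wtv_single_aux, wtv_single_aux] at *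
        have : wtv n r s 0 = 0 := by simp [wtv]
        rw [this]
        split_ifs at * <;> simp_all
      have h := congrFun (hb.injOn hsum h0 hz) k
      simp at h
  by_cases hz : ∃ k, m k ≠ 0
  · obtain ⟨k, hk⟩ := hz
    refine ⟨m k, k, ?_⟩
    funext i
    by_cases h : i = k
    · subst h
      simp
    · rw [Pi.single_eq_of_ne h]
      by_contra hi
      exact h (key i k hi hk)
  · push Not at hz
    refine ⟨0, ⟨0, by omega⟩, ?_⟩
    funext i
    simp [hz i]
end

section
/- Assume r ≥ 2 and 0 < s < n. A finite set Γ ⊆ (Fin n → ℕ) is a G-graph if and only if there exist indices i, j with i < s ≤ j < n and an integer t with 1 ≤ t ≤ r such that Γ = {a·e_j : 0 ≤ a ≤ r − t} ∪ {b·e_i : 1 ≤ b ≤ t − 1}, where e_k denotes the k-th standard exponent vector. (This is the classification of torus-fixed points of the G-Hilbert scheme Y_{s,n,r} obtained in the proof of Proposition 3.1, equation (3.2).) -/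
lemma wtv_add (n r s : ℕ) (m m' : Fin n → ℕ) :
    wtv n r s (m + m') = wtv n r s m + wtv n r s m' := by
  have h1 : ∀ (p : Fin n → Prop) [DecidablePred p],
      (∑ j : Fin n, if p j then (((m + m') j : ℕ) : ZMod r) else 0) =
      (∑ j : Fin n, if p j then (m j : ZMod r) else 0) +
      (∑ j : Fin n, if p j then (m' j : ZMod r) else 0) := by
    intro p _
    rw [← Finset.sum_add_distrib]
    refine Finset.sum_congr rfl fun j _ => ?_
    split_ifs <;> simp
  unfold wtv
  rw [h1, h1]
  ring

lemma wtv_aux (n r : ℕ) (k : Fin n) (a : ℕ) (p : Fin n → Prop) [DecidablePred p] :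
    (∑ j : Fin n, if p j then (((Pi.single k a : Fin n → ℕ) j : ℕ) : ZMod r) else 0) =
      if p k then (a : ZMod r) else 0 := by
  rw [Finset.sum_eq_single k]
  · simp
  · intro b _ hb
    simp [Pi.single_eq_of_ne hb]
  · simp

lemma wtv_pos (n r s : ℕ) (k : Fin n) (hk : s ≤ (k : ℕ)) (a : ℕ) :
    wtv n r s (Pi.single k a) = a := by
  unfold wtv
  rw [wtv_aux, wtv_aux, if_pos hk, if_neg (by omega), sub_zero]

lemma wtv_neg (n r s : ℕ) (k : Fin n) (hk : (k : ℕ) < s) (a : ℕ) :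
    wtv n r s (Pi.single k a) = -a := by
  unfold wtv
  rw [wtv_aux, wtv_aux, if_pos hk, if_neg (by omega), zero_sub]

lemma le_single_eq {n : ℕ} (k : Fin n) (a : ℕ) (m : Fin n → ℕ)
    (h : m ≤ Pi.single k a) : m = Pi.single k (m k) ∧ m k ≤ a := by
  refine ⟨?_, by simpa using h k⟩
  funext l
  by_cases hl : l = k
  · subst hl; simp
  · have := h l
    rw [Pi.single_eq_of_ne hl] at this ⊢
    exact Nat.le_zero.1 this

lemma single_le_of {n : ℕ} (k : Fin n) (a : ℕ) (m : Fin n → ℕ) (h : a ≤ m k) :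
    Pi.single k a ≤ m := by
  intro l
  by_cases hl : l = k
  · subst hl; simpa using h
  · simp [Pi.single_eq_of_ne hl]

lemma exists_bound {n : ℕ} (Γ : Finset (Fin n → ℕ)) (h0 : 0 ∈ Γ)
    (hd : ∀ m ∈ Γ, ∀ m' : Fin n → ℕ, m' ≤ m → m' ∈ Γ) (k : Fin n) :
    ∃ A : ℕ, 1 ≤ A ∧ ∀ a : ℕ, (Pi.single k a : Fin n → ℕ) ∈ Γ ↔ a < A := by
  classical
  have hex : ∃ a : ℕ, (Pi.single k a : Fin n → ℕ) ∉ Γ := by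
    by_contra! hc
    exact Set.infinite_of_injective_forall_mem (Pi.single_injective (M := fun _ : Fin n => ℕ) k)
      (s := (Γ : Set (Fin n → ℕ))) hc Γ.finite_toSet
  refine ⟨Nat.find hex, ?_, fun a => ⟨fun ha => ?_, fun ha => ?_⟩⟩
  · rw [Nat.one_le_iff_ne_zero]
    intro h
    have := Nat.find_spec hex
    rw [h] at this
    simp [h0] at this
  · by_contra! hc
    refine Nat.find_spec hex (hd _ ha _ (single_le_of _ _ _ ?_))
    simpa using hc
  · have := Nat.find_min hex ha
    simpa using this

lemma ggraph_card {n : ℕ} (r t : ℕ) (ht : 1 ≤ t) (i j : Fin n) (hij : i ≠ j) :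
    ((Finset.range (r + 1)).image (fun a => (Pi.single j a : Fin n → ℕ)) ∪
              (Finset.Icc 1 (t - 1)).image (fun b => (Pi.single i b : Fin n → ℕ))).card
      = r + t := by
  rw [Finset.card_union_of_disjoint, Finset.card_image_of_injective _ (Pi.single_injective j),
    Finset.card_image_of_injective _ (Pi.single_injective i)]
  · simp; omega
  · rw [Finset.disjoint_left]
    intro m hm hm'
    simp only [Finset.mem_image, Finset.mem_Icc] at hm hm'
    obtain ⟨a, _, rfl⟩ := hm
    obtain ⟨b, hb, h⟩ := hm'
    have := congrFun h i
    simp [Pi.single_eq_of_ne hij] at this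
    omega

lemma ggraph_forward (n r s : ℕ) (hr : 2 ≤ r) (hs0 : 0 < s) (hsn : s < n)
    (Γ : Finset (Fin n → ℕ)) (h : IsGGraph n r s Γ) :
      ∃ (i j : Fin n) (t : ℕ), (i : ℕ) < s ∧ s ≤ (j : ℕ) ∧ 1 ≤ t ∧ t ≤ r ∧
        Γ = (Finset.range (r - t + 1)).image (fun a => Pi.single j a) ∪
              (Finset.Icc 1 (t - 1)).image (fun b => Pi.single i b) := by
  obtain ⟨h0, hd, hb⟩ := h
  have hinj := hb.injOn
  have s1 : ∀ k l : Fin n, (Pi.single k 1 : Fin n → ℕ) ∈ Γ → (Pi.single l 1 : Fin n → ℕ) ∈ Γ →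
      wtv n r s (Pi.single k 1) = wtv n r s (Pi.single l 1) → k = l := by
    intro k l hk hl hw
    have := congrFun (hinj hk hl hw) k
    by_contra hkl
    simp [Pi.single_eq_of_ne hkl] at this
  have sp : ∀ k l : Fin n, s ≤ (k : ℕ) → s ≤ (l : ℕ) → (Pi.single k 1 : Fin n → ℕ) ∈ Γ →
      (Pi.single l 1 : Fin n → ℕ) ∈ Γ → k = l := fun k l hk hl hk' hl' =>
    s1 k l hk' hl' (by rw [wtv_pos _ _ _ _ hk, wtv_pos _ _ _ _ hl])
  have sn : ∀ k l : Fin n, (k : ℕ) < s → (l : ℕ) < s → (Pi.single k 1 : Fin n → ℕ) ∈ Γ →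
      (Pi.single l 1 : Fin n → ℕ) ∈ Γ → k = l := fun k l hk hl hk' hl' =>
    s1 k l hk' hl' (by rw [wtv_neg _ _ _ _ hk, wtv_neg _ _ _ _ hl])
  have mixed : ∀ m ∈ Γ, ∀ k l : Fin n, (k : ℕ) < s → s ≤ (l : ℕ) → m k ≠ 0 → m l ≠ 0 → False := by
    intro m hm k l hk hl hmk hml
    have hkl : k ≠ l := by rintro rfl; omega
    have hin : (Pi.single k 1 + Pi.single l 1 : Fin n → ℕ) ∈ Γ := by
      refine hd m hm _ fun x => ?_
      by_cases hxk : x = k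
      · subst hxk
        simp [Pi.single_eq_of_ne hkl]; omega
      · by_cases hxl : x = l
        · subst hxl
          simp [Pi.single_eq_of_ne hxk]; omega
        · simp [Pi.single_eq_of_ne hxk, Pi.single_eq_of_ne hxl]
    have hw : wtv n r s (Pi.single k 1 + Pi.single l 1) = wtv n r s 0 := by
      rw [wtv_add, wtv_pos _ _ _ _ hl, wtv_neg _ _ _ _ hk]
      simp [wtv]
    have := congrFun (hinj hin h0 hw) k
    simp at this
  have one_mem : ∀ m ∈ Γ, ∀ k : Fin n, m k ≠ 0 → (Pi.single k 1 : Fin n → ℕ) ∈ Γ :=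
    fun m hm k hk => hd m hm _ (single_le_of _ _ _ (by omega))
  obtain ⟨j, hj, hjΓ⟩ : ∃ j : Fin n, s ≤ (j : ℕ) ∧ ∀ k : Fin n, s ≤ (k : ℕ) →
      (Pi.single k 1 : Fin n → ℕ) ∈ Γ → k = j := by
    by_cases hc : ∃ j : Fin n, s ≤ (j : ℕ) ∧ (Pi.single j 1 : Fin n → ℕ) ∈ Γ
    · obtain ⟨j, hj, hj'⟩ := hc
      exact ⟨j, hj, fun k hk hk' => sp k j hk hj hk' hj'⟩
    · exact ⟨⟨s, hsn⟩, le_rfl, fun k hk hk' => (hc ⟨k, hk, hk'⟩).elim⟩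
  obtain ⟨i, hi, hiΓ⟩ : ∃ i : Fin n, (i : ℕ) < s ∧ ∀ k : Fin n, (k : ℕ) < s →
      (Pi.single k 1 : Fin n → ℕ) ∈ Γ → k = i := by
    by_cases hc : ∃ j : Fin n, (j : ℕ) < s ∧ (Pi.single j 1 : Fin n → ℕ) ∈ Γ
    · obtain ⟨j, hj, hj'⟩ := hc
      exact ⟨j, hj, fun k hk hk' => sn k j hk hj hk' hj'⟩
    · exact ⟨⟨0, by omega⟩, hs0, fun k hk hk' => (hc ⟨k, hk, hk'⟩).elim⟩
  have hij : i ≠ j := by rintro rfl; omega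
  obtain ⟨A, hA1, hA⟩ := exists_bound Γ h0 hd j
  obtain ⟨B, hB1, hB⟩ := exists_bound Γ h0 hd i
  have key : Γ = (Finset.range (A - 1 + 1)).image (fun a => Pi.single j a) ∪
              (Finset.Icc 1 (B - 1)).image (fun b => Pi.single i b) := by
    ext m
    simp only [Finset.mem_union, Finset.mem_image, Finset.mem_range, Finset.mem_Icc]
    constructor
    · intro hm
      by_cases hmi : m i = 0
      · left
        have hmj : Pi.single j (m j) = m := by
          funext x
          by_cases hx : x = j
          · subst hx; simp
          · rw [Pi.single_eq_of_ne hx]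
            by_contra hne
            have h1 := one_mem m hm x (Ne.symm hne)
            rcases lt_or_ge (x : ℕ) s with hxs | hxs
            · exact hne (by rw [hiΓ x hxs h1, hmi])
            · exact hx (hjΓ x hxs h1)
        refine ⟨m j, ?_, hmj⟩
        have := (hA (m j)).1 (by rw [hmj]; exact hm)
        omega
      · right
        have hmj : Pi.single i (m i) = m := by
          funext x
          by_cases hx : x = i
          · subst hx; simp
          · rw [Pi.single_eq_of_ne hx]
            by_contra hne
            have h1 := one_mem m hm x (Ne.symm hne)
            rcases lt_or_ge (x : ℕ) s with hxs | hxs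
            · exact hx (hiΓ x hxs h1)
            · exact mixed m hm i x hi hxs hmi (Ne.symm hne)
        refine ⟨m i, ?_, hmj⟩
        have := (hB (m i)).1 (by rw [hmj]; exact hm)
        omega
    · rintro (⟨a, ha, rfl⟩ | ⟨b, hb', rfl⟩)
      · exact (hA a).2 (by omega)
      · exact (hB b).2 (by omega)
  have hcard : Γ.card = r := by
    haveI : NeZero r := ⟨by omega⟩
    have h1 := hb.image_eq
    have h2 := Set.ncard_image_of_injOn hinj
    rw [h1, Set.ncard_univ, Nat.card_eq_fintype_card, ZMod.card, Set.ncard_coe_finset] at h2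
    exact h2.symm
  have hc2 := ggraph_card (A - 1) B hB1 i j hij
  rw [← key, hcard] at hc2
  refine ⟨i, j, B, hi, hj, hB1, by omega, ?_⟩
  rw [show r - B = A - 1 by omega]
  exact key

lemma ggraph_backward (n r s : ℕ) (hr : 2 ≤ r) (i j : Fin n) (t : ℕ)
    (hi : (i : ℕ) < s) (hj : s ≤ (j : ℕ)) (ht : 1 ≤ t) (htr : t ≤ r) :
    IsGGraph n r s ((Finset.range (r - t + 1)).image (fun a => Pi.single j a) ∪
              (Finset.Icc 1 (t - 1)).image (fun b => Pi.single i b)) := by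
  haveI : NeZero r := ⟨by omega⟩
  have hij : i ≠ j := by rintro rfl; omega
  have hcard := ggraph_card (r - t) t ht i j hij
  set Γ := (Finset.range (r - t + 1)).image (fun a => (Pi.single j a : Fin n → ℕ)) ∪
              (Finset.Icc 1 (t - 1)).image (fun b => (Pi.single i b : Fin n → ℕ)) with hΓ
  have hmem : ∀ m, m ∈ Γ ↔ (∃ a < r - t + 1, Pi.single j a = m) ∨
      (∃ b, (1 ≤ b ∧ b ≤ t - 1) ∧ Pi.single i b = m) := by
    intro m
    simp only [hΓ, Finset.mem_union, Finset.mem_image, Finset.mem_range, Finset.mem_Icc]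
  have h0 : (0 : Fin n → ℕ) ∈ Γ := (hmem _).2 (Or.inl ⟨0, by omega, by simp⟩)
  have hsurj : Set.SurjOn (wtv n r s) (Γ : Set (Fin n → ℕ)) Set.univ := by
    intro x _
    have hx : ((x.val : ℕ) : ZMod r) = x := ZMod.natCast_zmod_val x
    have hlt := ZMod.val_lt x
    by_cases hc : x.val ≤ r - t
    · exact ⟨Pi.single j x.val, (hmem _).2 (Or.inl ⟨_, by omega, rfl⟩), by
        rw [wtv_pos _ _ _ _ hj, hx]⟩
    · refine ⟨Pi.single i (r - x.val), (hmem _).2 (Or.inr ⟨_, by omega, rfl⟩), ?_⟩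
      rw [wtv_neg _ _ _ _ hi, Nat.cast_sub hlt.le, hx]
      simp
  refine ⟨h0, ?_, Set.mapsTo_univ _ _, ?_, hsurj⟩
  · intro m hm m' hle
    rcases (hmem m).1 hm with ⟨a, ha, rfl⟩ | ⟨b, hb, rfl⟩
    · obtain ⟨h1, h2⟩ := le_single_eq _ _ _ hle
      exact (hmem _).2 (Or.inl ⟨m' j, by omega, h1.symm⟩)
    · obtain ⟨h1, h2⟩ := le_single_eq _ _ _ hle
      by_cases h3 : m' i = 0
      · rw [h3, Pi.single_zero] at h1
        rw [h1]; exact h0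
      · exact (hmem _).2 (Or.inr ⟨m' i, by omega, h1.symm⟩)
  · apply Finset.injOn_of_surjOn_of_card_le (t := Finset.univ) (wtv n r s)
    · intro x _; simp
    · simpa using hsurj
    · rw [hcard, Finset.card_univ, ZMod.card]; omega

/-- (Classification of torus-fixed points, eq. (3.2).)
For `r ≥ 2`, `0 < s < n`, a finite set `Γ` is a `G`-graph iff there are
`i < s ≤ j < n` and `1 ≤ t ≤ r` with
`Γ = {a·e_j : 0 ≤ a ≤ r − t} ∪ {b·e_i : 1 ≤ b ≤ t − 1}`. -/
theorem gGraph_iff (n r s : ℕ) (hr : 2 ≤ r) (hs0 : 0 < s) (hsn : s < n)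
    (Γ : Finset (Fin n → ℕ)) :
    IsGGraph n r s Γ ↔
      ∃ (i j : Fin n) (t : ℕ), (i : ℕ) < s ∧ s ≤ (j : ℕ) ∧ 1 ≤ t ∧ t ≤ r ∧
        Γ = (Finset.range (r - t + 1)).image (fun a => Pi.single j a) ∪
              (Finset.Icc 1 (t - 1)).image (fun b => Pi.single i b) := by
  constructor
  · exact ggraph_forward n r s hr hs0 hsn Γ
  · rintro ⟨i, j, t, hi, hj, ht, htr, rfl⟩
    exact ggraph_backward n r s hr i j t hi hj ht htr
end

section
/- Assume r ≥ 2 and fix indices i, j with i < s ≤ j < n and an integer t with 1 ≤ t ≤ r. Let I = I_t^{ij} ⊆ R be the monomial ideal defined below. Then the images in R/I of the r monomials z_j^a for 0 ≤ a ≤ r − t together with z_i^b for 1 ≤ b ≤ t − 1 form a basis of R/I as a ℂ-vector space; in particular dim_ℂ(R/I) = r. (These quotients realize the regular representation of G = ℤ/rℤ at the torus-fixed points of the G-Hilbert scheme; see equation (3.2).) -/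
open MvPolynomial

/-- The monomial ideal `I_t^{ij} ⊆ R = ℂ[z_0,…,z_{n−1}]`, generated by the
variables `z_k` for `k < s`, `k ≠ i`; the variables `z_k` for `s ≤ k < n`,
`k ≠ j`; and the monomials `z_i^t`, `z_j^{r−t+1}` and `z_i·z_j`. -/
noncomputable def idealItij (n r s : ℕ) (i j : Fin n) (t : ℕ) :
    Ideal (MvPolynomial (Fin n) ℂ) :=
  Ideal.span
    ({ p | ∃ k : Fin n, (((k : ℕ) < s ∧ k ≠ i) ∨ (s ≤ (k : ℕ) ∧ k ≠ j)) ∧ p = X k } ∪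
      {X i ^ t, X j ^ (r - t + 1), X i * X j})


/-- Exponents of the monomials lying in the ideal. -/
def BadExp {n : ℕ} (r : ℕ) (i j : Fin n) (t : ℕ) (m : Fin n →₀ ℕ) : Prop :=
  (∃ k, k ≠ i ∧ k ≠ j ∧ 1 ≤ m k) ∨ t ≤ m i ∨ r - t + 1 ≤ m j ∨ (1 ≤ m i ∧ 1 ≤ m j)

/-- Exponents of the basis monomials. -/
noncomputable def basisExp {n : ℕ} (r : ℕ) (i j : Fin n) (t : ℕ) (a : ℕ) : Fin n →₀ ℕ :=
  if a ≤ r - t then Finsupp.single j a else Finsupp.single i (a - (r - t))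

lemma mem_idealItij (n r s : ℕ) (i j : Fin n) (hi : (i : ℕ) < s) (hj : s ≤ (j : ℕ))
    (t : ℕ) (p : MvPolynomial (Fin n) ℂ) :
    p ∈ idealItij n r s i j t ↔ ∀ m ∈ p.support, BadExp r i j t m := by
  have hij : i ≠ j := by rintro rfl; omega
  have hI : idealItij n r s i j t = Ideal.span ((fun m => monomial m (1 : ℂ)) ''
      ({ m | ∃ k : Fin n, (k ≠ i ∧ k ≠ j) ∧ m = Finsupp.single k 1 } ∪
        {Finsupp.single i t, Finsupp.single j (r - t + 1),
          Finsupp.single i 1 + Finsupp.single j 1})) := by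
    unfold idealItij
    congr 1
    rw [Set.image_union, Set.image_insert_eq, Set.image_insert_eq, Set.image_singleton]
    congr 1
    · ext p
      constructor
      · rintro ⟨k, hk, rfl⟩
        refine ⟨_, ⟨k, ?_, rfl⟩, rfl⟩
        constructor
        · rintro rfl; omega
        · rintro rfl; omega
      · rintro ⟨_, ⟨k, ⟨h1, h2⟩, rfl⟩, rfl⟩
        refine ⟨k, ?_, rfl⟩
        rcases lt_or_ge (k : ℕ) s with h | h
        · exact Or.inl ⟨h, h1⟩
        · exact Or.inr ⟨h, h2⟩
    · simp only [X_pow_eq_monomial]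
      simp [X, monomial_mul]
  rw [hI, mem_ideal_span_monomial_image]
  refine forall₂_congr fun m _ => ?_
  unfold BadExp
  constructor
  · rintro ⟨e, (⟨k, ⟨h1, h2⟩, rfl⟩ | rfl | rfl | rfl), he⟩
    · exact Or.inl ⟨k, h1, h2, by simpa using he k⟩
    · exact Or.inr (Or.inl (by simpa using he i))
    · exact Or.inr (Or.inr (Or.inl (by simpa using he j)))
    · refine Or.inr (Or.inr (Or.inr ⟨?_, ?_⟩))
      · have := he i
        simp at this; omega
      · have := he j
        simp at this; omega
  · rintro (⟨k, h1, h2, h⟩ | h | h | ⟨h1, h2⟩)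
    · exact ⟨_, Or.inl ⟨k, ⟨h1, h2⟩, rfl⟩, by simpa using h⟩
    · exact ⟨_, Or.inr (Or.inl rfl), by simpa using h⟩
    · exact ⟨_, Or.inr (Or.inr (Or.inl rfl)), Finsupp.single_le_iff.mpr h⟩
    · refine ⟨_, Or.inr (Or.inr (Or.inr rfl)), fun k => ?_⟩
      simp only [Finsupp.add_apply, Finsupp.single_apply]
      split_ifs with h h' h'
      · exact absurd (h.trans h'.symm) hij
      · subst h; omega
      · subst h'; omega
      · omega

lemma basisExp_j {n r : ℕ} {i j : Fin n} (hij : i ≠ j) (t a : ℕ) :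
    basisExp r i j t a j = if a ≤ r - t then a else 0 := by
  unfold basisExp; split_ifs <;> simp [hij]

lemma basisExp_i {n r : ℕ} {i j : Fin n} (hij : i ≠ j) (t a : ℕ) :
    basisExp r i j t a i = if a ≤ r - t then 0 else a - (r - t) := by
  unfold basisExp; split_ifs <;> simp [hij.symm]

lemma basisExp_k {n r : ℕ} {i j k : Fin n} (hi : k ≠ i) (hj : k ≠ j) (t a : ℕ) :
    basisExp r i j t a k = 0 := by
  unfold basisExp; split_ifs <;> simp [hi.symm, hj.symm]

lemma basisExp_inj {n r : ℕ} {i j : Fin n} (hij : i ≠ j) {t a b : ℕ}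
    (h : basisExp r i j t a = basisExp r i j t b) : a = b := by
  have h1 := DFunLike.congr_fun h i
  have h2 := DFunLike.congr_fun h j
  rw [basisExp_i hij, basisExp_i hij] at h1
  rw [basisExp_j hij, basisExp_j hij] at h2
  split_ifs at h1 h2 <;> omega

lemma basisExp_good {n r : ℕ} {i j : Fin n} (hij : i ≠ j) {t a : ℕ} (ht1 : 1 ≤ t) (ht2 : t ≤ r)
    (ha : a < r) : ¬ BadExp r i j t (basisExp r i j t a) := by
  rintro (⟨k, h1, h2, h⟩ | h | h | ⟨h, h'⟩)
  · rw [basisExp_k h1 h2] at h; omega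
  · rw [basisExp_i hij] at h; split_ifs at h <;> omega
  · rw [basisExp_j hij] at h; split_ifs at h <;> omega
  · rw [basisExp_i hij] at h
    rw [basisExp_j hij] at h'
    split_ifs at h h' <;> omega

lemma exists_basisExp {n r : ℕ} {i j : Fin n} (hij : i ≠ j) {t : ℕ} (ht1 : 1 ≤ t) (ht2 : t ≤ r)
    {m : Fin n →₀ ℕ} (hm : ¬ BadExp r i j t m) : ∃ a : Fin r, m = basisExp r i j t a := by
  unfold BadExp at hm
  push Not at hm
  obtain ⟨h0, h1, h2, h3⟩ := hm
  have key : ∀ a : ℕ, m i = (if a ≤ r - t then 0 else a - (r - t)) →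
      m j = (if a ≤ r - t then a else 0) → m = basisExp r i j t a := by
    intro a hai haj
    ext k
    by_cases hki : k = i
    · subst hki; rw [basisExp_i hij, hai]
    by_cases hkj : k = j
    · subst hkj; rw [basisExp_j hij, haj]
    rw [basisExp_k hki hkj]
    have := h0 k hki hkj
    omega
  by_cases hmi : 1 ≤ m i
  · have := h3 hmi
    refine ⟨⟨m i + (r - t), by omega⟩, key _ ?_ ?_⟩ <;> dsimp only <;> split_ifs <;> omega
  · refine ⟨⟨m j, by omega⟩, key _ ?_ ?_⟩ <;> dsimp only <;> split_ifs <;> omega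

/-- (Equation (3.2).) For `r ≥ 2`, `i < s ≤ j < n`,
`1 ≤ t ≤ r`, the images in `R/I_t^{ij}` of the `r` monomials
`z_j^a` (`0 ≤ a ≤ r − t`) and `z_i^b` (`1 ≤ b ≤ t − 1`) form a `ℂ`-basis of
`R/I_t^{ij}`; in particular `dim_ℂ (R/I_t^{ij}) = r`. -/
theorem quotient_basis (n r s : ℕ) (hr : 2 ≤ r) (hs0 : 0 < s) (hsn : s < n)
    (i j : Fin n) (hi : (i : ℕ) < s) (hj : s ≤ (j : ℕ))
    (t : ℕ) (ht1 : 1 ≤ t) (ht2 : t ≤ r) :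
    LinearIndependent ℂ
        (fun a : Fin r =>
          Ideal.Quotient.mk (idealItij n r s i j t)
            (if (a : ℕ) ≤ r - t then X j ^ (a : ℕ) else X i ^ ((a : ℕ) - (r - t)))) ∧
      Submodule.span ℂ
          (Set.range fun a : Fin r =>
            Ideal.Quotient.mk (idealItij n r s i j t)
              (if (a : ℕ) ≤ r - t then X j ^ (a : ℕ) else X i ^ ((a : ℕ) - (r - t)))) = ⊤ ∧
      Module.finrank ℂ (MvPolynomial (Fin n) ℂ ⧸ idealItij n r s i j t) = r := by
  have hij : i ≠ j := by rintro rfl; omega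
  have hmon : ∀ a : Fin r, (if (a : ℕ) ≤ r - t then X j ^ (a : ℕ) else X i ^ ((a : ℕ) - (r - t)) :
      MvPolynomial (Fin n) ℂ) = monomial (basisExp r i j t a) 1 := by
    intro a
    unfold basisExp
    split_ifs <;> rw [X_pow_eq_monomial]
  simp only [hmon]
  have hsmul : ∀ (c : ℂ) (p : MvPolynomial (Fin n) ℂ),
      Ideal.Quotient.mk (idealItij n r s i j t) (c • p) =
        c • Ideal.Quotient.mk (idealItij n r s i j t) p := fun _ _ => rfl
  have hli : LinearIndependent ℂ (fun a : Fin r =>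
      Ideal.Quotient.mk (idealItij n r s i j t) (monomial (basisExp r i j t a) 1)) := by
    rw [Fintype.linearIndependent_iff]
    intro g hg a
    simp only [← hsmul] at hg
    rw [← map_sum, Ideal.Quotient.eq_zero_iff_mem, mem_idealItij n r s i j hi hj] at hg
    by_contra hne
    refine basisExp_good hij ht1 ht2 a.2 (hg _ ?_)
    rw [mem_support_iff, coeff_sum, Finset.sum_eq_single a]
    · simpa using hne
    · intro b _ hb
      have : basisExp r i j t b ≠ basisExp r i j t a :=
        fun h => hb (Fin.ext (basisExp_inj hij h))
      simp [coeff_monomial, this]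
    · simp
  have hsp : Submodule.span ℂ (Set.range fun a : Fin r =>
      Ideal.Quotient.mk (idealItij n r s i j t) (monomial (basisExp r i j t a) 1)) = ⊤ := by
    rw [eq_top_iff]
    rintro x -
    obtain ⟨p, rfl⟩ := Ideal.Quotient.mk_surjective x
    rw [p.as_sum, map_sum]
    refine Submodule.sum_mem _ fun m _ => ?_
    have : monomial m (coeff m p) = coeff m p • monomial m (1 : ℂ) := by
      simp [smul_monomial]
    rw [this, hsmul]
    refine Submodule.smul_mem _ _ ?_
    by_cases hm : BadExp r i j t m
    · have : Ideal.Quotient.mk (idealItij n r s i j t) (monomial m (1 : ℂ)) = 0 := by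
        rw [Ideal.Quotient.eq_zero_iff_mem, mem_idealItij n r s i j hi hj]
        intro m' hm'
        have := support_monomial_subset hm'
        rw [Finset.mem_singleton] at this
        rwa [this]
      rw [this]
      exact Submodule.zero_mem _
    · obtain ⟨a, rfl⟩ := exists_basisExp hij ht1 ht2 hm
      exact Submodule.subset_span ⟨a, rfl⟩
  refine ⟨hli, hsp, ?_⟩
  rw [Module.finrank_eq_card_basis (Module.Basis.mk hli hsp.ge), Fintype.card_fin]
end

section
/- Assume r ≥ 2 and fix indices i, j with i < s ≤ j < n and an integer t with 1 ≤ t ≤ r. Let I = I_t^{ij} ⊆ R be the monomial ideal defined below. Then σ(I) = I, so σ induces a ring automorphism σ̄ of R/I, and the set of R-module homomorphisms η : I → R/I satisfying the equivariance condition η(σ(x)) = σ̄(η(x)) for all x ∈ I forms a ℂ-linear subspace of Hom_R(I, R/I) of dimension exactly n. (This is Proposition 3.1(2): the Zariski tangent space to the G-Hilbert scheme Y_{s,n,r} at each torus-fixed point has dimension n, which yields the smoothness of Y_{s,n,r}.) -/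
open MvPolynomial

/-- The `ℂ`-algebra automorphism `σ` of `R = ℂ[z_0,…,z_{n−1}]` determined by
`σ(z_i) = ω·z_i` for `i < s` and `σ(z_i) = ω⁻¹·z_i` for `s ≤ i < n`. -/
noncomputable def sigmaAct (n s : ℕ) (ω : ℂ) :
    MvPolynomial (Fin n) ℂ →ₐ[ℂ] MvPolynomial (Fin n) ℂ :=
  MvPolynomial.aeval fun i : Fin n =>
    if (i : ℕ) < s then ω • MvPolynomial.X i else ω⁻¹ • MvPolynomial.X i

namespace TangentAux

/-- Character of a variable. -/
noncomputable def chiV (n s : ℕ) (ω : ℂ) (k : Fin n) : ℂ := if (k : ℕ) < s then ω else ω⁻¹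

/-- Character of a monomial. -/
noncomputable def chi (n s : ℕ) (ω : ℂ) (u : Fin n →₀ ℕ) : ℂ :=
  u.prod fun k e => chiV n s ω k ^ e

/-- The standard monomial of weight `e`. -/
noncomputable def std {n : ℕ} (r : ℕ) (i j : Fin n) (t e : ℕ) : Fin n →₀ ℕ :=
  if e < t then Finsupp.single i e else Finsupp.single j (r - e)

/-- The generator exponents indexed by the variables. -/
noncomputable def gExp {n : ℕ} (r : ℕ) (i j : Fin n) (t : ℕ) (k : Fin n) : Fin n →₀ ℕ :=
  if k = i then Finsupp.single i t else
    if k = j then Finsupp.single j (r - t + 1) else Finsupp.single k 1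

/-- Weight of the generator indexed by `k`. -/
def ew {n : ℕ} (r s : ℕ) (i j : Fin n) (t : ℕ) (k : Fin n) : ℕ :=
  if k = i then t % r else if k = j then t - 1 else if (k : ℕ) < s then 1 else r - 1

/-- All exponents of generators. -/
def gens {n : ℕ} (r : ℕ) (i j : Fin n) (t : ℕ) : Set (Fin n →₀ ℕ) :=
  Set.range (gExp r i j t) ∪ {Finsupp.single i 1 + Finsupp.single j 1}

theorem chi_add {n s : ℕ} {ω : ℂ} (u v : Fin n →₀ ℕ) :
    chi n s ω (u + v) = chi n s ω u * chi n s ω v := by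
  unfold chi
  exact Finsupp.prod_add_index' (by simp) (by intros; rw [pow_add])

theorem chi_single {n s : ℕ} {ω : ℂ} (k : Fin n) (e : ℕ) :
    chi n s ω (Finsupp.single k e) = chiV n s ω k ^ e := by
  unfold chi
  rw [Finsupp.prod_single_index]; simp

theorem sigma_monomial {n s : ℕ} {ω : ℂ} (u : Fin n →₀ ℕ) (c : ℂ) :
    sigmaAct n s ω (monomial u c) = chi n s ω u • monomial u c := by
  unfold sigmaAct
  rw [aeval_monomial]
  have : ∀ k : Fin n, (if (k : ℕ) < s then ω • X k else ω⁻¹ • X k : MvPolynomial (Fin n) ℂ)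
      = C (chiV n s ω k) * X k := by
    intro k; unfold chiV; split_ifs <;> simp [smul_eq_C_mul]
  simp_rw [this, mul_pow]
  rw [Finsupp.prod_mul, monomial_eq, smul_eq_C_mul]
  have h2 : (u.prod fun k e => (C (chiV n s ω k) : MvPolynomial (Fin n) ℂ) ^ e)
      = C (chi n s ω u) := by
    unfold chi
    simp [Finsupp.prod, map_prod]
  rw [h2, algebraMap_eq]; ring

theorem coeff_sigma {n s : ℕ} {ω : ℂ} (u : Fin n →₀ ℕ) (f : MvPolynomial (Fin n) ℂ) :
    coeff u (sigmaAct n s ω f) = chi n s ω u * coeff u f := by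
  induction f using MvPolynomial.induction_on' with
  | monomial v c =>
    rw [sigma_monomial, coeff_smul, coeff_monomial, smul_eq_mul]
    split_ifs with h
    · rw [h]
    · simp
  | add p q hp hq => rw [map_add, coeff_add, hp, hq, coeff_add, mul_add]

theorem ideal_eq {n r s : ℕ} {i j : Fin n} (hi : (i : ℕ) < s) (hj : s ≤ (j : ℕ)) (t : ℕ) :
    idealItij n r s i j t =
      Ideal.span ((fun u => monomial u (1 : ℂ)) '' gens r i j t) := by
  have hij : j ≠ i := by rintro rfl; omega
  unfold idealItij gens
  congr 1
  ext p
  simp only [Set.mem_union, Set.mem_ofPred_eq, Set.mem_insert_iff, Set.mem_singleton_iff,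
    Set.mem_image, Set.mem_range]
  constructor
  · rintro (⟨k, hk, rfl⟩ | rfl | rfl | rfl)
    · have h1 : k ≠ i := by rintro rfl; rcases hk with hk | hk <;> [exact hk.2 rfl; omega]
      have h2 : k ≠ j := by rintro rfl; rcases hk with hk | hk <;> [omega; exact hk.2 rfl]
      exact ⟨_, Or.inl ⟨k, rfl⟩, by simp [gExp, h1, h2, X]⟩
    · exact ⟨_, Or.inl ⟨i, rfl⟩, by simp [gExp, X_pow_eq_monomial]⟩
    · exact ⟨_, Or.inl ⟨j, rfl⟩, by simp [gExp, X_pow_eq_monomial, hij]⟩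
    · exact ⟨_, Or.inr rfl, by simp [X, monomial_mul]⟩
  · rintro ⟨u, ⟨k, rfl⟩ | rfl, rfl⟩
    · unfold gExp
      split_ifs with h1 h2
      · simp [X_pow_eq_monomial]
      · simp [X_pow_eq_monomial]
      · exact Or.inl ⟨k, by omega, rfl⟩
    · simp [X, monomial_mul]

theorem gens_iff {n r : ℕ} {i j : Fin n} (hij : i ≠ j) {t : ℕ} (ht1 : 1 ≤ t) (ht2 : t ≤ r)
    (u : Fin n →₀ ℕ) :
    (∃ v ∈ gens r i j t, v ≤ u) ↔ ¬ ∃ e < r, u = std r i j t e := by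
  have hg : (∃ v ∈ gens r i j t, v ≤ u) ↔
      (∃ k, k ≠ i ∧ k ≠ j ∧ 1 ≤ u k) ∨ t ≤ u i ∨ r - t + 1 ≤ u j ∨ (1 ≤ u i ∧ 1 ≤ u j) := by
    constructor
    · rintro ⟨v, ⟨k, rfl⟩ | rfl, h⟩
      · unfold gExp at h
        split_ifs at h with h1 h2
        · have := h i; simp at this; tauto
        · have := h j; simp at this; tauto
        · have := h k; simp at this; exact Or.inl ⟨k, h1, h2, by omega⟩
      · have h1 := h i
        have h2 := h j
        simp [hij, hij.symm] at h1 h2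
        right; right; right; omega
    · rintro (⟨k, h1, h2, h3⟩ | h | h | ⟨h1, h2⟩)
      · exact ⟨_, Or.inl ⟨k, rfl⟩, by simpa [gExp, h1, h2] using h3⟩
      · exact ⟨_, Or.inl ⟨i, rfl⟩, by simpa [gExp] using h⟩
      · exact ⟨_, Or.inl ⟨j, rfl⟩, by
          rw [gExp, if_neg hij.symm, if_pos rfl, Finsupp.single_le_iff]; exact h⟩
      · refine ⟨_, Or.inr rfl, ?_⟩
        intro k
        by_cases hk : k = i
        · subst hk; simpa [hij.symm, hij] using h1
        · by_cases hk' : k = j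
          · subst hk'; simpa [hij.symm, hij] using h2
          · simp [Ne.symm hk, Ne.symm hk']
  rw [hg]
  constructor
  · rintro h ⟨e, he, rfl⟩
    unfold std at h
    split_ifs at h with h1
    · rcases h with ⟨k, h2, h3, h4⟩ | h | h | h
      · simp [Ne.symm h2] at h4
      · simp at h; omega
      · simp [hij] at h
      · simp [hij] at h
    · rcases h with ⟨k, h2, h3, h4⟩ | h | h | h
      · simp [Ne.symm h3] at h4
      · simp [hij.symm] at h; omega
      · simp at h; omega
      · simp [hij.symm] at h
  · intro h
    by_contra hc
    push Not at hc
    obtain ⟨h1, h2, h3, h4⟩ := hc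
    apply h
    by_cases h0 : u j = 0
    · refine ⟨u i, by omega, ?_⟩
      unfold std
      rw [if_pos h2]
      ext k
      by_cases hk : k = i
      · subst hk; simp
      · by_cases hk' : k = j
        · subst hk'; simp [hij, h0]
        · have := h1 k hk hk'
          simp [Ne.symm hk]; omega
    · refine ⟨r - u j, by omega, ?_⟩
      unfold std
      rw [if_neg (by omega)]
      have h0i : u i = 0 := by
        by_contra hne
        have := h4 (by omega)
        omega
      ext k
      by_cases hk : k = j
      · subst hk; simp; omega
      · by_cases hk' : k = i
        · subst hk'; simp [hij.symm, h0i]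
        · have := h1 k hk' hk
          simp [Ne.symm hk]; omega

theorem mem_iff {n r s : ℕ} {i j : Fin n} (hi : (i : ℕ) < s) (hj : s ≤ (j : ℕ))
    {t : ℕ} (ht1 : 1 ≤ t) (ht2 : t ≤ r) (f : MvPolynomial (Fin n) ℂ) :
    f ∈ idealItij n r s i j t ↔ ∀ e < r, coeff (std r i j t e) f = 0 := by
  have hij : i ≠ j := by rintro rfl; omega
  rw [ideal_eq hi hj, mem_ideal_span_monomial_image]
  simp_rw [gens_iff hij ht1 ht2]
  constructor
  · intro h e he
    by_contra hc
    exact h _ (mem_support_iff.2 hc) ⟨e, he, rfl⟩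
  · rintro h u hu ⟨e, he, rfl⟩
    exact mem_support_iff.1 hu (h e he)

theorem chi_std {n r s : ℕ} {i j : Fin n} (hi : (i : ℕ) < s) (hj : s ≤ (j : ℕ))
    {ω : ℂ} (hω : ω ^ r = 1) (hω0 : ω ≠ 0) {t e : ℕ} (he : e ≤ r) :
    chi n s ω (std r i j t e) = ω ^ e := by
  unfold std
  split_ifs with h
  · rw [chi_single, chiV, if_pos hi]
  · rw [chi_single, chiV, if_neg (by omega), inv_pow]
    apply inv_eq_of_mul_eq_one_right
    rw [← pow_add, Nat.sub_add_cancel he, hω]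

theorem chi_gExp {n r s : ℕ} (hr : 2 ≤ r) {i j : Fin n} (hi : (i : ℕ) < s) (hj : s ≤ (j : ℕ))
    {ω : ℂ} (hω : ω ^ r = 1) (hω0 : ω ≠ 0) {t : ℕ} (ht1 : 1 ≤ t) (ht2 : t ≤ r) (k : Fin n) :
    chi n s ω (gExp r i j t k) = ω ^ ew r s i j t k := by
  have hinv : ∀ a b, a + b = r → (ω⁻¹) ^ a = ω ^ b := by
    intro a b h
    rw [inv_pow]
    apply inv_eq_of_mul_eq_one_right
    rw [← pow_add, h, hω]
  unfold gExp ew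
  split_ifs with h1 h2 h3
  · rw [chi_single, chiV, if_pos hi]
    conv_lhs => rw [← Nat.mod_add_div t r, pow_add, pow_mul, hω, one_pow, mul_one]
  · rw [chi_single, chiV, if_neg (by omega)]
    exact hinv _ _ (by omega)
  · rw [chi_single, chiV, if_pos h3]
  · rw [chi_single, chiV, if_neg h3]
    exact hinv _ _ (by omega)

theorem ew_lt {n r s : ℕ} (hr : 2 ≤ r) {i j : Fin n} {t : ℕ} (ht1 : 1 ≤ t) (ht2 : t ≤ r)
    (k : Fin n) : ew r s i j t k < r := by
  unfold ew
  split_ifs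
  · exact Nat.mod_lt _ (by omega)
  all_goals omega

theorem exists_hom {R M : Type*} [CommRing R] [AddCommGroup M] [Module R M] (S : Set R)
    (φ : R →+ M) (h : ∀ g ∈ S, ∀ p, φ (p * g) = p • φ g) :
    ∃ η : (Ideal.span S : Ideal R) →ₗ[R] M, ∀ x, η x = φ x := by
  have key : ∀ x ∈ Ideal.span S, ∀ p, φ (p * x) = p • φ x := by
    intro x hx
    induction hx using Submodule.span_induction with
    | mem x hx => exact h x hx
    | zero => simp
    | add x y _ _ hx hy => intro p; rw [mul_add, map_add, hx, hy, map_add, smul_add]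
    | smul a x _ hx =>
      intro p
      rw [smul_eq_mul, ← mul_assoc, hx, hx, mul_smul]
  exact ⟨{ toFun := fun x => φ x
           map_add' := fun x y => by simp
           map_smul' := fun a x => by simpa using key x.1 x.2 a }, fun x => rfl⟩

/-- `divMonomial` as an additive map. -/
noncomputable def divHom {n : ℕ} (v : Fin n →₀ ℕ) :
    MvPolynomial (Fin n) ℂ →+ MvPolynomial (Fin n) ℂ where
  toFun f := f.divMonomial v
  map_zero' := zero_divMonomial v
  map_add' x y := add_divMonomial x y v

theorem divHom_mul_single {n : ℕ} {q l : Fin n} (h : l ≠ q) (a b : ℕ)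
    (p : MvPolynomial (Fin n) ℂ) :
    divHom (Finsupp.single q a) (p * monomial (Finsupp.single l b) 1) =
      divHom (Finsupp.single q a) p * monomial (Finsupp.single l b) 1 := by
  ext m
  simp only [divHom, AddMonoidHom.coe_mk, ZeroHom.coe_mk]
  rw [coeff_divMonomial, coeff_mul_monomial', coeff_mul_monomial', coeff_divMonomial]
  have h1 : Finsupp.single l b ≤ Finsupp.single q a + m ↔ Finsupp.single l b ≤ m := by
    simp [Finsupp.single_le_iff, h]
  simp only [h1]
  split_ifs with h2
  · rw [add_tsub_assoc_of_le h2]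
  · rfl

theorem gExp_mem {n r : ℕ} {i j : Fin n} {t : ℕ} (k : Fin n) :
    gExp r i j t k ∈ gens r i j t := Or.inl ⟨k, rfl⟩

theorem xy_mem {n r : ℕ} {i j : Fin n} {t : ℕ} :
    Finsupp.single i 1 + Finsupp.single j 1 ∈ gens r i j t := Or.inr rfl

theorem mono_mem {n r s : ℕ} {i j : Fin n} (hi : (i : ℕ) < s) (hj : s ≤ (j : ℕ)) {t : ℕ}
    {v : Fin n →₀ ℕ} (hv : v ∈ gens r i j t) :
    monomial v (1 : ℂ) ∈ idealItij n r s i j t := by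
  rw [ideal_eq hi hj]
  exact Ideal.subset_span ⟨v, hv, rfl⟩

theorem exists_phi_add {n r s : ℕ} (hr : 2 ≤ r) {i j : Fin n} (hi : (i : ℕ) < s)
    (hj : s ≤ (j : ℕ)) {t : ℕ} (ht1 : 1 ≤ t) (ht2 : t ≤ r) (k : Fin n) :
    ∃ φ : MvPolynomial (Fin n) ℂ →+ MvPolynomial (Fin n) ℂ,
      (∀ p l, φ (p * monomial (gExp r i j t l) 1) -
        p * (if l = k then monomial (std r i j t (ew r s i j t k)) 1 else 0)
          ∈ idealItij n r s i j t) ∧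
      (∀ p, φ (p * monomial (Finsupp.single i 1 + Finsupp.single j 1) 1)
          ∈ idealItij n r s i j t) := by
  have hij : i ≠ j := by rintro rfl; omega
  set I := idealItij n r s i j t with hI
  by_cases hki : k = i
  · subst hki
    have hm : std r k j t (ew r s k j t k) = Finsupp.single j (r - t) := by
      unfold ew std
      rw [if_pos rfl]
      rcases Nat.lt_or_ge t r with h | h
      · rw [Nat.mod_eq_of_lt h, if_neg (by omega)]
      · obtain rfl : t = r := by omega
        simp
    rw [hm]
    refine ⟨(AddMonoidHom.mulLeft (monomial (Finsupp.single j (r - t)) 1)).comp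
      (divHom (Finsupp.single k t)), ?_, ?_⟩
    · intro p l
      simp only [AddMonoidHom.comp_apply, AddMonoidHom.coe_mulLeft]
      by_cases hl : l = k
      · subst hl
        have h2 : divHom (Finsupp.single l t) (p * monomial (gExp r l j t l) 1) = p := by
          simp [divHom, gExp]
        rw [h2, if_pos rfl, mul_comm, sub_self]
        exact I.zero_mem
      · rw [if_neg hl, mul_zero, sub_zero]
        have h3 : ∃ b, gExp r k j t l = Finsupp.single l b := by
          unfold gExp
          rw [if_neg hl]
          split_ifs with h
          · exact ⟨_, by rw [h]⟩
          · exact ⟨_, rfl⟩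
        obtain ⟨b, hb⟩ := h3
        have h4 := mono_mem (s := s) hi hj (gExp_mem (r := r) (i := k) (j := j) (t := t) l)
        rw [hb] at h4 ⊢
        rw [divHom_mul_single hl]
        exact I.mul_mem_left _ (I.mul_mem_left _ h4)
    · intro p
      simp only [AddMonoidHom.comp_apply, AddMonoidHom.coe_mulLeft]
      have h4 := mono_mem (s := s) hi hj (gExp_mem (r := r) (i := k) (j := j) (t := t) j)
      have h5 : (monomial (Finsupp.single k 1 + Finsupp.single j 1) (1 : ℂ)) =
        monomial (Finsupp.single k 1) 1 * monomial (Finsupp.single j 1) 1 := by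
          simp [monomial_mul]
      rw [h5, ← mul_assoc, divHom_mul_single hij.symm, mul_left_comm, monomial_mul,
        ← Finsupp.single_add, mul_one]
      unfold gExp at h4
      rw [if_neg hij.symm, if_pos rfl] at h4
      exact I.mul_mem_left _ h4
  by_cases hkj : k = j
  · subst hkj
    have hm : std r i k t (ew r s i k t k) = Finsupp.single i (t - 1) := by
      unfold ew std
      rw [if_neg hki, if_pos rfl, if_pos (by omega)]
    rw [hm]
    refine ⟨(AddMonoidHom.mulLeft (monomial (Finsupp.single i (t - 1)) 1)).comp
      (divHom (Finsupp.single k (r - t + 1))), ?_, ?_⟩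
    · intro p l
      simp only [AddMonoidHom.comp_apply, AddMonoidHom.coe_mulLeft]
      by_cases hl : l = k
      · subst hl
        have h2 : divHom (Finsupp.single l (r - t + 1)) (p * monomial (gExp r i l t l) 1) = p := by
          simp [divHom, gExp, hki]
        rw [h2, if_pos rfl, mul_comm, sub_self]
        exact I.zero_mem
      · rw [if_neg hl, mul_zero, sub_zero]
        have h3 : ∃ b, gExp r i k t l = Finsupp.single l b := by
          unfold gExp
          split_ifs with h
          · exact ⟨_, by rw [h]⟩
          · exact ⟨_, rfl⟩
        obtain ⟨b, hb⟩ := h3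
        have h4 := mono_mem (s := s) hi hj (gExp_mem (r := r) (i := i) (j := k) (t := t) l)
        rw [hb] at h4 ⊢
        rw [divHom_mul_single hl]
        exact I.mul_mem_left _ (I.mul_mem_left _ h4)
    · intro p
      simp only [AddMonoidHom.comp_apply, AddMonoidHom.coe_mulLeft]
      have h4 := mono_mem (s := s) hi hj (gExp_mem (r := r) (i := i) (j := k) (t := t) i)
      have h5 : (monomial (Finsupp.single i 1 + Finsupp.single k 1) (1 : ℂ)) =
        monomial (Finsupp.single k 1) 1 * monomial (Finsupp.single i 1) 1 := by
          simp [monomial_mul, add_comm]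
      rw [h5, ← mul_assoc, divHom_mul_single hij, mul_left_comm, monomial_mul,
        ← Finsupp.single_add, mul_one, Nat.sub_add_cancel ht1]
      unfold gExp at h4
      rw [if_pos rfl] at h4
      exact I.mul_mem_left _ h4
  · refine ⟨(AddMonoidHom.mulLeft (monomial (std r i j t (ew r s i j t k)) 1)).comp
      (pderiv k).toLinearMap.toAddMonoidHom, ?_, ?_⟩
    · intro p l
      have h4 := mono_mem (s := s) hi hj (gExp_mem (r := r) (i := i) (j := j) (t := t) l)
      have h6 : pderiv k (monomial (gExp r i j t l) (1 : ℂ)) = if l = k then 1 else 0 := by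
        unfold gExp
        split_ifs with h1 h2 h3 h4 h5
        · exact absurd (h2 ▸ h1) hki
        · simp [pderiv_monomial, Ne.symm hki]
        · exact absurd (h4 ▸ h3) hkj
        · simp [pderiv_monomial, Ne.symm hkj]
        · subst h5; simp [pderiv_monomial]
        · simp [pderiv_monomial, h5]
      have : ((AddMonoidHom.mulLeft (monomial (std r i j t (ew r s i j t k)) 1)).comp
          (pderiv k).toLinearMap.toAddMonoidHom) (p * monomial (gExp r i j t l) 1) =
          monomial (std r i j t (ew r s i j t k)) 1 * pderiv k (p * monomial (gExp r i j t l) 1) :=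
        rfl
      rw [this, Derivation.leibniz, h6]
      have h7 : monomial (std r i j t (ew r s i j t k)) 1 *
          (p • (if l = k then 1 else 0) + monomial (gExp r i j t l) (1 : ℂ) • pderiv k p) -
          p * (if l = k then monomial (std r i j t (ew r s i j t k)) 1 else 0)
          = (monomial (std r i j t (ew r s i j t k)) 1 * pderiv k p)
            * monomial (gExp r i j t l) (1 : ℂ) := by
        simp only [smul_eq_mul]
        split_ifs <;> ring
      rw [h7]
      exact I.mul_mem_left _ h4
    · intro p
      have h4 := mono_mem (s := s) hi hj (xy_mem (r := r) (i := i) (j := j) (t := t))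
      have h6 : pderiv k (monomial (Finsupp.single i 1 + Finsupp.single j 1) (1 : ℂ)) = 0 := by
        simp [pderiv_monomial, Ne.symm hki, Ne.symm hkj]
      have : ((AddMonoidHom.mulLeft (monomial (std r i j t (ew r s i j t k)) 1)).comp
          (pderiv k).toLinearMap.toAddMonoidHom)
            (p * monomial (Finsupp.single i 1 + Finsupp.single j 1) 1) =
          monomial (std r i j t (ew r s i j t k)) 1 *
            pderiv k (p * monomial (Finsupp.single i 1 + Finsupp.single j 1) 1) :=
        rfl
      rw [this, Derivation.leibniz, h6, smul_zero, zero_add, smul_eq_mul]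
      exact I.mul_mem_left _ (I.mul_mem_right _ h4)

theorem exists_phi {n r s : ℕ} (hr : 2 ≤ r) {i j : Fin n} (hi : (i : ℕ) < s)
    (hj : s ≤ (j : ℕ)) {t : ℕ} (ht1 : 1 ≤ t) (ht2 : t ≤ r) (k : Fin n) :
    ∃ η : (idealItij n r s i j t) →ₗ[MvPolynomial (Fin n) ℂ]
              (MvPolynomial (Fin n) ℂ ⧸ idealItij n r s i j t),
      (∀ l, η ⟨_, mono_mem hi hj (gExp_mem l)⟩ =
        if l = k then Ideal.Quotient.mk _ (monomial (std r i j t (ew r s i j t k)) 1) else 0) ∧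
      η ⟨_, mono_mem hi hj xy_mem⟩ = 0 := by
  obtain ⟨φ, h1, h2⟩ := exists_phi_add hr hi hj ht1 ht2 k
  have h1' : ∀ p l, Ideal.Quotient.mk (idealItij n r s i j t)
      (φ (p * monomial (gExp r i j t l) 1)) = p • Ideal.Quotient.mk (idealItij n r s i j t)
        (if l = k then monomial (std r i j t (ew r s i j t k)) 1 else 0) := by
    intro p l
    have := Ideal.Quotient.eq.2 (h1 p l)
    rw [this, map_mul]
    rfl
  have h2' : ∀ p, Ideal.Quotient.mk (idealItij n r s i j t)
      (φ (p * monomial (Finsupp.single i 1 + Finsupp.single j 1) 1)) = 0 := fun p =>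
    Ideal.Quotient.eq_zero_iff_mem.2 (h2 p)
  have key := exists_hom ((fun u => monomial u (1 : ℂ)) '' gens r i j t)
    ((Ideal.Quotient.mk (idealItij n r s i j t)).toAddMonoidHom.comp φ) (by
      rintro _ ⟨v, ⟨l, rfl⟩ | rfl, rfl⟩ p
      · have := h1' 1 l
        rw [one_mul, one_smul] at this
        refine (h1' p l).trans ?_
        rw [← this]; rfl
      · have := h2' 1
        rw [one_mul] at this
        refine (h2' p).trans ?_
        have h3 : ((Ideal.Quotient.mk (idealItij n r s i j t)).toAddMonoidHom.comp φ)
          (monomial (Finsupp.single i 1 + Finsupp.single j 1) 1) = 0 := this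
        simp only [h3, smul_zero])
  rw [← ideal_eq hi hj] at key
  obtain ⟨η, hη⟩ := key
  refine ⟨η, ?_, ?_⟩
  · intro l
    have := h1' 1 l
    rw [one_mul, one_smul] at this
    rw [hη]
    refine this.trans ?_
    split_ifs <;> simp
  · rw [hη]
    have := h2' 1
    rw [one_mul] at this
    exact this

theorem hom_ext_span {R M : Type*} [CommRing R] [AddCommGroup M] [Module R M] (S : Set R)
    (I : Ideal R) (hI : I = Ideal.span S) (η η' : I →ₗ[R] M)
    (h : ∀ g ∈ S, ∀ hg : g ∈ I, η ⟨g, hg⟩ = η' ⟨g, hg⟩) : η = η' := by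
  subst hI
  have : ∀ x (hx : x ∈ Ideal.span S), η ⟨x, hx⟩ = η' ⟨x, hx⟩ := by
    intro x hx
    induction hx using Submodule.span_induction with
    | mem x hx => exact h x hx _
    | zero => exact (map_zero η).trans (map_zero η').symm
    | add x y hx' hy' hx hy =>
      have := congrArg₂ (· + ·) hx hy
      simp only [← map_add] at this
      exact this
    | smul a x hx' hx =>
      have := congrArg (a • ·) hx
      simp only [← map_smul] at this
      exact this
  ext ⟨x, hx⟩
  exact this x hx

theorem equivar_span {R : Type*} [CommRing R] (S : Set R)
    (I : Ideal R) (hI : I = Ideal.span S) (σ : R →+* R) (hle : I ≤ Ideal.comap σ I)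
    (η : I →ₗ[R] R ⧸ I)
    (h : ∀ g ∈ S, ∀ hg : g ∈ I, η ⟨σ g, hle hg⟩ = Ideal.quotientMap I σ hle (η ⟨g, hg⟩))
    (x : R) (hx : x ∈ I) : η ⟨σ x, hle hx⟩ = Ideal.quotientMap I σ hle (η ⟨x, hx⟩) := by
  subst hI
  induction hx using Submodule.span_induction with
  | mem x hx => exact h x hx _
  | zero =>
    have h1 : (⟨σ 0, hle (Ideal.zero_mem _)⟩ : Ideal.span S) = 0 := Subtype.ext (map_zero σ)
    have h2 : (⟨0, Ideal.zero_mem _⟩ : Ideal.span S) = 0 := rfl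
    rw [h1, h2, map_zero, map_zero]
  | add x y hx' hy' hx hy =>
    have h1 : (⟨σ (x + y), hle (Ideal.add_mem _ hx' hy')⟩ : Ideal.span S) =
      ⟨σ x, hle hx'⟩ + ⟨σ y, hle hy'⟩ := Subtype.ext (map_add σ x y)
    have h2 : (⟨x + y, Ideal.add_mem _ hx' hy'⟩ : Ideal.span S) = ⟨x, hx'⟩ + ⟨y, hy'⟩ := rfl
    rw [h1, h2, map_add, map_add, map_add, hx, hy]
  | smul a x hx' hx =>
    have h1 : (⟨σ (a • x), hle (Submodule.smul_mem _ a hx')⟩ : Ideal.span S) =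
      σ a • ⟨σ x, hle hx'⟩ := Subtype.ext (by simp)
    have h2 : (⟨a • x, Submodule.smul_mem _ a hx'⟩ : Ideal.span S) = a • ⟨x, hx'⟩ := rfl
    rw [h1, h2, map_smul, map_smul, hx, Algebra.smul_def, Algebra.smul_def, map_mul]
    rfl

theorem std_inj_chi {n r s : ℕ} {i j : Fin n} (hi : (i : ℕ) < s)
    (hj : s ≤ (j : ℕ)) {t : ℕ} {ω : ℂ} (hω : IsPrimitiveRoot ω r)
    (hω0 : ω ≠ 0) {e e' : ℕ} (he : e < r) (he' : e' < r)
    (h : std r i j t e = std r i j t e') : e = e' := by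
  apply hω.pow_inj he he'
  rw [← chi_std (t := t) hi hj hω.pow_eq_one hω0 he.le,
    ← chi_std (t := t) hi hj hω.pow_eq_one hω0 he'.le, h]

theorem eigen {n r s : ℕ} {i j : Fin n} (hi : (i : ℕ) < s)
    (hj : s ≤ (j : ℕ)) {t : ℕ} (ht1 : 1 ≤ t) (ht2 : t ≤ r) {ω : ℂ} (hω : IsPrimitiveRoot ω r)
    (hω0 : ω ≠ 0)
    (hle : idealItij n r s i j t ≤
          Ideal.comap (sigmaAct n s ω).toRingHom (idealItij n r s i j t))
    (e : ℕ) (he : e < r) (v : MvPolynomial (Fin n) ℂ ⧸ idealItij n r s i j t)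
    (hv : Ideal.quotientMap (idealItij n r s i j t) (sigmaAct n s ω).toRingHom hle v
      = ω ^ e • v) :
    ∃ c : ℂ, v = c • Ideal.Quotient.mk (idealItij n r s i j t) (monomial (std r i j t e) 1) := by
  obtain ⟨f, rfl⟩ := Ideal.Quotient.mk_surjective v
  refine ⟨coeff (std r i j t e) f, ?_⟩
  have h1 : Ideal.Quotient.mk (idealItij n r s i j t) (sigmaAct n s ω f) =
      Ideal.Quotient.mk (idealItij n r s i j t) (ω ^ e • f) := hv
  rw [Ideal.Quotient.eq, mem_iff hi hj ht1 ht2] at h1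
  have h2 : coeff (std r i j t e) f •
      Ideal.Quotient.mk (idealItij n r s i j t) (monomial (std r i j t e) 1) =
      Ideal.Quotient.mk (idealItij n r s i j t)
        (coeff (std r i j t e) f • (monomial (std r i j t e) 1)) := rfl
  rw [h2, Ideal.Quotient.eq, mem_iff hi hj ht1 ht2]
  intro e' he'
  rw [coeff_sub, coeff_smul, coeff_monomial]
  split_ifs with h
  · rw [h]; simp
  · have h3 := h1 e' he'
    rw [coeff_sub, coeff_smul, coeff_sigma, chi_std hi hj hω.pow_eq_one hω0 he'.le, smul_eq_mul,
      ← sub_mul] at h3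
    rcases mul_eq_zero.1 h3 with h4 | h4
    · exact absurd (by rw [hω.pow_inj he' he (sub_eq_zero.1 h4)]) h
    · simp [h4]

theorem mk_std_ne {n r s : ℕ} {i j : Fin n} (hi : (i : ℕ) < s)
    (hj : s ≤ (j : ℕ)) {t : ℕ} (ht1 : 1 ≤ t) (ht2 : t ≤ r) {e : ℕ} (he : e < r) :
    Ideal.Quotient.mk (idealItij n r s i j t) (monomial (std r i j t e) 1) ≠ 0 := by
  rw [Ne, Ideal.Quotient.eq_zero_iff_mem, mem_iff hi hj ht1 ht2]
  intro h
  have := h e he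
  simp at this

theorem map_eq {n r s : ℕ} {i j : Fin n} (hi : (i : ℕ) < s)
    (hj : s ≤ (j : ℕ)) {t : ℕ} (ht1 : 1 ≤ t) (ht2 : t ≤ r) {ω : ℂ} (hω0 : ω ≠ 0) :
    Ideal.map (sigmaAct n s ω).toRingHom (idealItij n r s i j t) = idealItij n r s i j t := by
  have hchi : ∀ u, chi n s ω u ≠ 0 := by
    intro u
    unfold chi
    refine Finset.prod_ne_zero_iff.2 fun k _ => pow_ne_zero _ ?_
    unfold chiV
    split_ifs
    · exact hω0
    · exact inv_ne_zero hω0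
  apply le_antisymm
  · rw [Ideal.map_le_iff_le_comap]
    intro f hf
    rw [Ideal.mem_comap]
    change sigmaAct n s ω f ∈ _
    rw [mem_iff hi hj ht1 ht2] at hf ⊢
    intro e he
    rw [coeff_sigma, hf e he, mul_zero]
  · conv_lhs => rw [ideal_eq hi hj]
    rw [Ideal.span_le]
    rintro _ ⟨v, hv, rfl⟩
    have h1 := Ideal.mem_map_of_mem (sigmaAct n s ω).toRingHom (mono_mem (s := s) hi hj hv)
    have h2 : (sigmaAct n s ω).toRingHom (monomial v 1) = chi n s ω v • monomial v 1 :=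
      sigma_monomial v 1
    rw [h2] at h1
    have h3 := Ideal.mul_mem_left _ (C (chi n s ω v)⁻¹) h1
    rw [smul_eq_C_mul, ← mul_assoc, ← C_mul, inv_mul_cancel₀ (hchi v), C_1, one_mul] at h3
    exact h3

end TangentAux

/-- (Proposition 3.1(2).) `σ(I_t^{ij}) = I_t^{ij}`, so `σ`
induces a ring automorphism `σ̄` of `R/I_t^{ij}`, and the `G`-equivariant
`R`-module homomorphisms `η : I_t^{ij} → R/I_t^{ij}` (those with
`η(σ(x)) = σ̄(η(x))`) form a `ℂ`-subspace of `Hom_R(I, R/I)` of dimension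
exactly `n`. -/
theorem tangent_space_dim (n r s : ℕ) (hr : 2 ≤ r) (hs0 : 0 < s) (hsn : s < n)
    (ω : ℂ) (hω : ω = Complex.exp (2 * Real.pi * Complex.I / r))
    (i j : Fin n) (hi : (i : ℕ) < s) (hj : s ≤ (j : ℕ))
    (t : ℕ) (ht1 : 1 ≤ t) (ht2 : t ≤ r) :
    Ideal.map (sigmaAct n s ω).toRingHom (idealItij n r s i j t) = idealItij n r s i j t ∧
      ∀ hle : idealItij n r s i j t ≤
          Ideal.comap (sigmaAct n s ω).toRingHom (idealItij n r s i j t),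
        ∃ E : Submodule ℂ
            ((idealItij n r s i j t) →ₗ[MvPolynomial (Fin n) ℂ]
              (MvPolynomial (Fin n) ℂ ⧸ idealItij n r s i j t)),
          (E : Set ((idealItij n r s i j t) →ₗ[MvPolynomial (Fin n) ℂ]
                (MvPolynomial (Fin n) ℂ ⧸ idealItij n r s i j t))) =
              {η : (idealItij n r s i j t) →ₗ[MvPolynomial (Fin n) ℂ]
                  (MvPolynomial (Fin n) ℂ ⧸ idealItij n r s i j t) |
                ∀ (x : MvPolynomial (Fin n) ℂ) (hx : x ∈ idealItij n r s i j t),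
                  η ⟨sigmaAct n s ω x, Ideal.mem_comap.mp (hle hx)⟩ =
                    Ideal.quotientMap (idealItij n r s i j t) (sigmaAct n s ω).toRingHom hle
                      (η ⟨x, hx⟩)} ∧
            Module.finrank ℂ E = n := by
  classical
  have hr0 : r ≠ 0 := by omega
  have hprim : IsPrimitiveRoot ω r := hω ▸ Complex.isPrimitiveRoot_exp r hr0
  have hω0 : ω ≠ 0 := hprim.ne_zero hr0
  have hij : i ≠ j := by rintro rfl; omega
  refine ⟨TangentAux.map_eq hi hj ht1 ht2 hω0, ?_⟩
  intro hle
  choose φ hφ1 hφ2 using TangentAux.exists_phi (s := s) hr hi hj ht1 ht2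
  let Φ : (Fin n → ℂ) →ₗ[ℂ] ((idealItij n r s i j t) →ₗ[MvPolynomial (Fin n) ℂ]
              (MvPolynomial (Fin n) ℂ ⧸ idealItij n r s i j t)) :=
    Fintype.linearCombination ℂ φ
  have hΦ : ∀ c x, Φ c x = ∑ k, c k • φ k x := by
    intro c x
    simp [Φ, Fintype.linearCombination_apply, LinearMap.sum_apply]
  have hΦg : ∀ c l, Φ c ⟨_, TangentAux.mono_mem hi hj (TangentAux.gExp_mem l)⟩ =
      c l • Ideal.Quotient.mk _ (monomial (TangentAux.std r i j t
        (TangentAux.ew r s i j t l)) 1) := by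
    intro c l
    rw [hΦ, Finset.sum_eq_single l]
    · rw [hφ1, if_pos rfl]
    · intro k _ hk
      rw [hφ1, if_neg hk.symm, smul_zero]
    · simp
  have hΦxy : ∀ c, Φ c ⟨_, TangentAux.mono_mem hi hj TangentAux.xy_mem⟩ = 0 := by
    intro c
    rw [hΦ]
    simp [hφ2]
  have hlt := TangentAux.ew_lt (n := n) (s := s) (i := i) (j := j) hr ht1 ht2
  have hinj : Function.Injective Φ := by
    rw [injective_iff_map_eq_zero]
    intro c hc
    funext l
    have h1 := hΦg c l
    rw [hc, LinearMap.zero_apply] at h1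
    rcases smul_eq_zero.1 h1.symm with h | h
    · exact h
    · exact absurd h (TangentAux.mk_std_ne hi hj ht1 ht2 (hlt l))
  -- the action of `σ` on the source
  have hσmem : ∀ (η : (idealItij n r s i j t) →ₗ[MvPolynomial (Fin n) ℂ]
      (MvPolynomial (Fin n) ℂ ⧸ idealItij n r s i j t)) (v : Fin n →₀ ℕ)
      (hv : monomial v (1 : ℂ) ∈ idealItij n r s i j t),
      η ⟨sigmaAct n s ω (monomial v 1), Ideal.mem_comap.mp (hle hv)⟩ =
        TangentAux.chi n s ω v • η ⟨_, hv⟩ := by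
    intro η v hv
    have h1 : (⟨sigmaAct n s ω (monomial v 1), Ideal.mem_comap.mp (hle hv)⟩ :
        idealItij n r s i j t) = TangentAux.chi n s ω v • ⟨_, hv⟩ :=
      Subtype.ext (TangentAux.sigma_monomial v 1)
    rw [h1]
    exact LinearMap.map_smul_of_tower η _ _
  have hchixy : TangentAux.chi n s ω (Finsupp.single i 1 + Finsupp.single j 1) = 1 := by
    rw [TangentAux.chi_add, TangentAux.chi_single, TangentAux.chi_single, TangentAux.chiV,
      TangentAux.chiV, if_pos hi, if_neg (by omega), pow_one, pow_one, mul_inv_cancel₀ hω0]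
  have hchig := TangentAux.chi_gExp hr hi hj hprim.pow_eq_one hω0 ht1 ht2
  refine ⟨LinearMap.range Φ, ?_, ?_⟩
  · ext η
    constructor
    · rintro ⟨c, rfl⟩
      refine TangentAux.equivar_span _ _ (TangentAux.ideal_eq hi hj t) _ hle (Φ c) ?_
      rintro _ ⟨v, ⟨l, rfl⟩ | rfl, rfl⟩ hg
      · refine (hσmem (Φ c) _ hg).trans ?_
        rw [hchig, hΦg]
        change _ = Ideal.Quotient.mk _ (sigmaAct n s ω (c l • _))
        rw [map_smul, TangentAux.sigma_monomial,
          TangentAux.chi_std hi hj hprim.pow_eq_one hω0 (hlt l).le, smul_comm]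
        rfl
      · refine (hσmem (Φ c) _ hg).trans ?_
        rw [hΦxy, smul_zero, map_zero]
    · intro hη
      have hη' : ∀ v (hv : monomial v (1 : ℂ) ∈ idealItij n r s i j t),
          Ideal.quotientMap (idealItij n r s i j t) (sigmaAct n s ω).toRingHom hle
            (η ⟨_, hv⟩) = TangentAux.chi n s ω v • η ⟨_, hv⟩ := fun v hv =>
        (hη _ hv).symm.trans (hσmem η v hv)
      have hc : ∀ l, ∃ c : ℂ, η ⟨_, TangentAux.mono_mem hi hj (TangentAux.gExp_mem l)⟩ =
          c • Ideal.Quotient.mk _ (monomial (TangentAux.std r i j t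
            (TangentAux.ew r s i j t l)) 1) := by
        intro l
        apply TangentAux.eigen hi hj ht1 ht2 hprim hω0 hle _ (hlt l)
        rw [hη', hchig]
      choose c hc using hc
      have hxy : η ⟨_, TangentAux.mono_mem hi hj TangentAux.xy_mem⟩ = 0 := by
        obtain ⟨d, hd⟩ := TangentAux.eigen hi hj ht1 ht2 hprim hω0 hle 0 (by omega)
          (η ⟨_, TangentAux.mono_mem hi hj TangentAux.xy_mem⟩) (by rw [hη', hchixy, pow_zero])
        have hs0 : TangentAux.std r i j t 0 = 0 := by
          unfold TangentAux.std
          rw [if_pos (by omega), Finsupp.single_zero]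
        have hsi : TangentAux.std r i j t (TangentAux.ew r s i j t i) =
            Finsupp.single j (r - t) := by
          unfold TangentAux.ew TangentAux.std
          rw [if_pos rfl]
          rcases Nat.lt_or_ge t r with h | h
          · rw [Nat.mod_eq_of_lt h, if_neg (by omega)]
          · obtain rfl : t = r := by omega
            simp
        have hst : TangentAux.std r i j t (t - 1) = Finsupp.single i (t - 1) := by
          unfold TangentAux.std
          rw [if_pos (by omega)]
        have hrel : (monomial (Finsupp.single i (t - 1)) (1 : ℂ)) •
            (⟨_, TangentAux.mono_mem hi hj TangentAux.xy_mem⟩ : idealItij n r s i j t) =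
            (monomial (Finsupp.single j 1) (1 : ℂ)) •
              ⟨_, TangentAux.mono_mem hi hj (TangentAux.gExp_mem i)⟩ := by
          apply Subtype.ext
          simp only [Submodule.coe_smul, smul_eq_mul, monomial_mul, mul_one]
          congr 1
          rw [TangentAux.gExp, if_pos rfl, ← add_assoc, ← Finsupp.single_add,
            Nat.sub_add_cancel ht1, add_comm]
        have h1 := congrArg η hrel
        rw [map_smul, map_smul, hc i, hd, hs0, hsi, smul_comm, smul_comm _ (c i)] at h1
        have h2 : (monomial (Finsupp.single j 1) (1 : ℂ)) •
            Ideal.Quotient.mk (idealItij n r s i j t) (monomial (Finsupp.single j (r - t)) 1)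
              = 0 := by
          have h4 := TangentAux.mono_mem (s := s) hi hj
            (TangentAux.gExp_mem (r := r) (i := i) (j := j) (t := t) j)
          rw [TangentAux.gExp, if_neg hij.symm, if_pos rfl] at h4
          rw [← Ideal.Quotient.eq_zero_iff_mem] at h4
          rw [← h4, add_comm, Finsupp.single_add, ← one_mul (1 : ℂ), ← monomial_mul, one_mul]
          rfl
        have h3 : (monomial (Finsupp.single i (t - 1)) (1 : ℂ)) •
            Ideal.Quotient.mk (idealItij n r s i j t) (monomial 0 1)
              = Ideal.Quotient.mk (idealItij n r s i j t)
                (monomial (TangentAux.std r i j t (t - 1)) 1) := by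
          rw [hst]
          change Ideal.Quotient.mk _ (_ * _) = _
          rw [monomial_mul, add_zero, mul_one]
        rw [h2, h3, smul_zero] at h1
        rcases smul_eq_zero.1 h1 with h | h
        · rw [hd, h, zero_smul]
        · exact absurd h (TangentAux.mk_std_ne hi hj ht1 ht2 (by omega))
      refine ⟨c, ?_⟩
      refine TangentAux.hom_ext_span _ _ (TangentAux.ideal_eq hi hj t) _ _ ?_
      rintro _ ⟨v, ⟨l, rfl⟩ | rfl, rfl⟩ hg
      · exact (hΦg c l).trans (hc l).symm
      · exact (hΦxy c).trans hxy.symm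
  · rw [LinearMap.finrank_range_of_inj hinj]
    simp
end

section
/- Let n, r, s be integers with r ≥ 3, 0 < s < n, fix indices i, j with i < s ≤ j < n, and fix an integer t with 1 ≤ t ≤ r − 2. Let M be the n × n matrix over ℚ whose k-th column is the standard basis vector e_k for every k ∉ {i, j}, whose i-th column is v_t, and whose j-th column is v_{t+1}. Then det M = 1/r. (This is the unimodularity/volume computation of Remark 3.8: each maximal cone of the fan of the toric variety Y_{s,n,r}, obtained by star subdivisions of the positive orthant along the rays through v_1, …, v_{r−1}, has normalized volume 1/r with respect to ℤ^n, equal to the covolume of the lattice N, which gives the smoothness of Y_{s,n,r}.) -/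
/-- (Remark 3.8, volume computation.) Let `r ≥ 3`,
`0 < s < n`, `i < s ≤ j < n`, `1 ≤ t ≤ r − 2`, and let `v_u ∈ ℚ^n` have first
`s` coordinates `(r − u)/r` and last `n − s` coordinates `u/r`. If `M` is the
`n × n` rational matrix whose `k`-th column is `e_k` for `k ∉ {i, j}`, whose
`i`-th column is `v_t` and whose `j`-th column is `v_{t+1}`, then
`det M = 1/r`. -/
theorem cone_volume (n r s : ℕ) (hr : 3 ≤ r) (hs0 : 0 < s) (hsn : s < n)
    (i j : Fin n) (hi : (i : ℕ) < s) (hj : s ≤ (j : ℕ))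
    (t : ℕ) (ht1 : 1 ≤ t) (ht2 : t ≤ r - 2)
    (v : ℕ → Fin n → ℚ)
    (hv : ∀ (u : ℕ) (k : Fin n),
      v u k = if (k : ℕ) < s then ((r : ℚ) - u) / r else (u : ℚ) / r)
    (M : Matrix (Fin n) (Fin n) ℚ)
    (hM : ∀ row col : Fin n, M row col =
      if col = i then v t row
      else if col = j then v (t + 1) row
      else if row = col then 1 else 0) :
    M.det = 1 / r := by
  have hij : i ≠ j := by
    intro h
    rw [h] at hi
    omega
  have hr0 : (r : ℚ) ≠ 0 := by
    have : r ≠ 0 := by omega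
    exact_mod_cast this
  -- `M = 1 + U * V` is a rank-two update of the identity
  let U : Matrix (Fin n) (Fin 2) ℚ := Matrix.of fun row c =>
    if c = 0 then v t row - (if row = i then 1 else 0)
    else v (t + 1) row - (if row = j then 1 else 0)
  let V : Matrix (Fin 2) (Fin n) ℚ := Matrix.of fun c col =>
    if c = 0 then (if col = i then 1 else 0) else (if col = j then 1 else 0)
  have hMUV : M = 1 + U * V := by
    ext row col
    rw [hM, Matrix.add_apply, Matrix.mul_apply, Fin.sum_univ_two, Matrix.one_apply]
    simp only [U, V, Matrix.of_apply]
    by_cases h1 : col = i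
    · subst h1
      simp [hij]
    · by_cases h2 : col = j
      · subst h2
        simp [h1]
      · simp [h1, h2]
  have hji : ¬ ((j : ℕ) < s) := by omega
  rw [hMUV, Matrix.det_one_add_mul_comm, Matrix.det_fin_two]
  simp only [Matrix.add_apply, Matrix.mul_apply, U, V, Matrix.of_apply]
  simp [hv, hi, hji, hij, hij.symm]
  field_simp
  ring
end

section
/- Let n, r, s be integers with r ≥ 2 and 0 < s < n, and fix integers k, t with 1 ≤ k ≤ r − 1 and 1 ≤ t ≤ r − 1. Consider the set S(k, t) = { (r − t)·(∑_{i<s} m_i) + t·(∑_{s≤j<n} m_j) : m ∈ (Fin n → ℕ) with wt(m) = k in ℤ/rℤ } ⊆ ℕ. Then min(t·k, (r − t)·(r − k)) is the least element of S(k, t) (it belongs to S(k, t) and is a lower bound for it). (This computes the coefficient m_{χ_k, t} = min(t·k, (r−t)(r−k))/r of the exceptional divisor E_t in the G-Weil divisor M_{χ_k}, since for such m the pairing v_t · m equals (1/r)·((r−t)∑_{i<s} m_i + t∑_{s≤j<n} m_j); this recovers the formulas in equation (4.3) and Table 1.) -/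
/-- The set `S(k, t) = { (r − t)·∑_{i<s} m_i + t·∑_{s≤j<n} m_j : wt(m) = k }`,
whose least element divided by `r` is the coefficient `m_{χ_k, t}` of the
exceptional divisor `E_t` in the `G`-Weil divisor `M_{χ_k}`. -/
def Sset (n r s k t : ℕ) : Set ℕ :=
  { x | ∃ m : Fin n → ℕ, wtv n r s m = (k : ZMod r) ∧
      x = (r - t) * (∑ i : Fin n, if (i : ℕ) < s then m i else 0)
            + t * ∑ j : Fin n, if s ≤ (j : ℕ) then m j else 0 }

/-- (Equation (4.3) and Table 1.) For `r ≥ 2`, `0 < s < n`,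
`1 ≤ k ≤ r − 1` and `1 ≤ t ≤ r − 1`, the number `min(t·k, (r − t)·(r − k))` is
the least element of `S(k, t)`. -/
theorem least_of_Sset (n r s : ℕ) (hr : 2 ≤ r) (hs0 : 0 < s) (hsn : s < n)
    (k t : ℕ) (hk1 : 1 ≤ k) (hk2 : k ≤ r - 1) (ht1 : 1 ≤ t) (ht2 : t ≤ r - 1) :
    IsLeast (Sset n r s k t) (min (t * k) ((r - t) * (r - k))) := by
  have hcast : ∀ m : Fin n → ℕ, wtv n r s m =
      (((∑ j : Fin n, if s ≤ (j : ℕ) then m j else 0 : ℕ) : ℤ) -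
        ((∑ i : Fin n, if (i : ℕ) < s then m i else 0 : ℕ) : ℤ) : ℤ) := by
    intro m
    simp [wtv]
  constructor
  · rcases min_choice (t * k) ((r - t) * (r - k)) with h | h
    · rw [h]
      have hA : (∑ i : Fin n, if (i : ℕ) < s then
          (if i = (⟨s, hsn⟩ : Fin n) then k else 0) else 0) = 0 := by
        apply Finset.sum_eq_zero
        intro i _
        simp only [Fin.ext_iff]
        split_ifs <;> omega
      have hB : (∑ i : Fin n, if s ≤ (i : ℕ) then
          (if i = (⟨s, hsn⟩ : Fin n) then k else 0) else 0) = k := by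
        rw [Finset.sum_eq_single (⟨s, hsn⟩ : Fin n)]
        · simp
        · intro b _ hb
          simp [hb]
        · simp
      refine ⟨fun i => if i = (⟨s, hsn⟩ : Fin n) then k else 0, ?_, ?_⟩
      · rw [hcast, hA, hB]
        simp
      · rw [hA, hB]
        simp
    · rw [h]
      have hn : 0 < n := by omega
      have hA : (∑ i : Fin n, if (i : ℕ) < s then
          (if i = (⟨0, hn⟩ : Fin n) then r - k else 0) else 0) = r - k := by
        rw [Finset.sum_eq_single (⟨0, hn⟩ : Fin n)]
        · simp [hs0]
        · intro b _ hb
          simp [hb]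
        · simp
      have hB : (∑ i : Fin n, if s ≤ (i : ℕ) then
          (if i = (⟨0, hn⟩ : Fin n) then r - k else 0) else 0) = 0 := by
        apply Finset.sum_eq_zero
        intro i _
        simp only [Fin.ext_iff]
        split_ifs <;> omega
      refine ⟨fun i => if i = (⟨0, hn⟩ : Fin n) then r - k else 0, ?_, ?_⟩
      · rw [hcast, hA, hB, Nat.cast_sub (by omega)]
        simp
      · rw [hA, hB]
        simp
  · rintro x ⟨m, hm, rfl⟩
    rw [hcast] at hm
    generalize (∑ i : Fin n, if (i : ℕ) < s then m i else 0) = a at *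
    generalize (∑ j : Fin n, if s ≤ (j : ℕ) then m j else 0) = b at *
    have hm' : (((b : ℤ) - (a : ℤ) : ℤ) : ZMod r) = ((k : ℤ) : ZMod r) := by
      rw [hm]
      simp
    rw [ZMod.intCast_eq_intCast_iff_dvd_sub] at hm'
    obtain ⟨q, hq⟩ := hm'
    rcases le_or_gt q 0 with h | h
    · have h1 : (r : ℤ) * q ≤ 0 := mul_nonpos_of_nonneg_of_nonpos (by positivity) h
      have h2 : k ≤ b := by omega
      exact (min_le_left _ _).trans ((Nat.mul_le_mul_left t h2).trans (Nat.le_add_left _ _))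
    · have h1 : (r : ℤ) * 1 ≤ r * q := mul_le_mul_of_nonneg_left h (by positivity)
      have h2 : r - k ≤ a := by omega
      exact (min_le_right _ _).trans
        ((Nat.mul_le_mul_left (r - t) h2).trans (Nat.le_add_right _ _))
end

section
/- Let n, r, s be integers with r ≥ 2 and 0 < s < n. For all integers k, ℓ with 1 ≤ k ≤ r − 1 and 1 ≤ ℓ ≤ r − 1, the least element of S(k, ℓ) equals the least element of S(r − ℓ, r − k). (This is the symmetry relation m_{χ_k, ℓ} = m_{χ_{r−ℓ}, r−k} of Remark 4.4 for the coefficients of the G-Weil divisors M_{χ}.) -/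
theorem Sset_isLeast (n r s : ℕ) (hs0 : 0 < s) (hsn : s < n)
    (k t : ℕ) (hk2 : k < r) :
    IsLeast (Sset n r s k t) (min (t * k) ((r - t) * (r - k))) := by
  constructor
  · rcases min_choice (t * k) ((r - t) * (r - k)) with h | h
    · rw [h]
      refine ⟨Pi.single ⟨s, hsn⟩ k, ?_, ?_⟩
      · unfold wtv
        rw [Finset.sum_eq_single (⟨s, hsn⟩ : Fin n), Finset.sum_eq_zero]
        · simp
        · intro i _
          split_ifs with hi
          · rw [Pi.single_eq_of_ne]
            · simp
            · rintro rfl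
              simp at hi
          · rfl
        · intro b _ hb
          simp [Pi.single_eq_of_ne hb]
        · simp
      · rw [Finset.sum_eq_zero, Finset.sum_eq_single (⟨s, hsn⟩ : Fin n)]
        · simp
        · intro b _ hb
          simp [Pi.single_eq_of_ne hb]
        · simp
        · intro i _
          split_ifs with hi
          · rw [Pi.single_eq_of_ne]
            rintro rfl
            simp at hi
          · rfl
    · rw [h]
      have h0 : 0 < n := by omega
      refine ⟨Pi.single ⟨0, h0⟩ (r - k), ?_, ?_⟩
      · unfold wtv
        rw [Finset.sum_eq_zero, Finset.sum_eq_single (⟨0, h0⟩ : Fin n)]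
        · simp [hs0, Nat.cast_sub hk2.le]
        · intro b _ hb
          simp [Pi.single_eq_of_ne hb]
        · simp
        · intro i _
          split_ifs with hi
          · rw [Pi.single_eq_of_ne]
            · simp
            · rintro rfl
              simp at hi
              omega
          · rfl
      · rw [Finset.sum_eq_single (⟨0, h0⟩ : Fin n), Finset.sum_eq_zero]
        · simp [hs0]
        · intro i _
          split_ifs with hi
          · rw [Pi.single_eq_of_ne]
            rintro rfl
            simp at hi
            omega
          · rfl
        · intro b _ hb
          simp [Pi.single_eq_of_ne hb]
        · simp
  · rintro x ⟨m, hw, rfl⟩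
    have hw' : (((∑ j : Fin n, if s ≤ (j : ℕ) then m j else 0 : ℕ) : ℤ) : ZMod r) -
        (((∑ i : Fin n, if (i : ℕ) < s then m i else 0 : ℕ) : ℤ) : ZMod r) = ((k : ℤ) : ZMod r) := by
      rw [Int.cast_natCast, Int.cast_natCast, Int.cast_natCast, ← hw]
      unfold wtv
      push_cast
      rfl
    generalize (∑ j : Fin n, if s ≤ (j : ℕ) then m j else 0) = B at *
    generalize (∑ i : Fin n, if (i : ℕ) < s then m i else 0) = A at *
    rw [← Int.cast_sub, ZMod.intCast_eq_intCast_iff_dvd_sub] at hw'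
    obtain ⟨q, hq⟩ := hw'
    rw [min_le_iff]
    rcases le_or_gt q 0 with h | h
    · left
      have : k ≤ B := by
        zify
        nlinarith
      nlinarith [Nat.mul_le_mul_left t this, Nat.zero_le ((r - t) * A)]
    · right
      have : r - k ≤ A := by
        zify [hk2.le]
        nlinarith
      nlinarith [Nat.mul_le_mul_left (r - t) this, Nat.zero_le (t * B)]

/-- (Remark 4.4, symmetry `m_{χ_k, ℓ} = m_{χ_{r−ℓ}, r−k}`.)
For `r ≥ 2`, `0 < s < n` and `1 ≤ k, ℓ ≤ r − 1`, the least element of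
`S(k, ℓ)` equals the least element of `S(r − ℓ, r − k)`. -/
theorem Sset_symmetry (n r s : ℕ) (hr : 2 ≤ r) (hs0 : 0 < s) (hsn : s < n)
    (k l : ℕ) (hk1 : 1 ≤ k) (hk2 : k ≤ r - 1) (hl1 : 1 ≤ l) (hl2 : l ≤ r - 1) :
    ∀ a : ℕ, IsLeast (Sset n r s k l) a ↔ IsLeast (Sset n r s (r - l) (r - k)) a := by
  have h1 := Sset_isLeast n r s hs0 hsn k l (by omega)
  have h2 := Sset_isLeast n r s hs0 hsn (r - l) (r - k) (by omega)
  have e : min ((r - k) * (r - l)) ((r - (r - k)) * (r - (r - l))) =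
      min (l * k) ((r - l) * (r - k)) := by
    rw [Nat.sub_sub_self (by omega), Nat.sub_sub_self (by omega), min_comm, mul_comm k,
      mul_comm (r - k)]
  rw [e] at h2
  intro a
  constructor
  · intro h
    rw [h.unique h1]
    exact h2
  · intro h
    rw [h.unique h2]
    exact h1
end
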